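/- arXiv:1202.1635 — 2 statements merged into one kernel-verified Lean document; each statement's English description precedes it below -/
import Mathlib

section
/- Let φ be a flow on a topological space X and let x ∈ L̄^r(X). Then x ∈ L̄^r(X) \ L^r(X) if and only if there exist an r-exterior open subset E ∈ ε^r(X) and t ∈ ℝ such that t·x lies in the frontier of E. -/
open Set

/-- An open subset `N` is r-exterior for the flow `φ` if for every point `x` there is
`t₀ ∈ ℝ` such that `φ t x ∈ N` for all `t ≥ t₀`. -/
def RExterior {X : Type*} [TopologicalSpace X] (φ : ℝ → X → X) (N : Set X) : Prop :=
  IsOpen N ∧ ∀ x : X, ∃ t₀ : ℝ, ∀ t : ℝ, t₀ ≤ t → φ t x ∈ N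

/-- The limit space `L^r(X)`: the intersection of all r-exterior open subsets. -/
def limitR {X : Type*} [TopologicalSpace X] (φ : ℝ → X → X) : Set X :=
  ⋂₀ {E : Set X | RExterior φ E}

/-- The bar-limit space `L̄^r(X)`. -/
def barLimitR {X : Type*} [TopologicalSpace X] (φ : ℝ → X → X) : Set X :=
  ⋂ E ∈ {E : Set X | RExterior φ E}, closure E

/-- The preimage of an r-exterior subset under a time-`s` map of the flow is r-exterior. -/
theorem RExterior.preimage {X : Type*} [TopologicalSpace X] {φ : ℝ → X → X} {E : Set X}
    (hE : RExterior φ E) (hcont : Continuous fun p : ℝ × X => φ p.1 p.2)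
    (hadd : ∀ t s x, φ t (φ s x) = φ (t + s) x) (s : ℝ) : RExterior φ (φ s ⁻¹' E) := by
  refine ⟨hE.1.preimage (hcont.comp (Continuous.prodMk_right s)), fun x => ?_⟩
  obtain ⟨t₀, ht₀⟩ := hE.2 x
  refine ⟨t₀ - s, fun t ht => ?_⟩
  rw [mem_preimage, hadd]
  exact ht₀ _ (by linarith)

/-- A point `x ∈ L̄^r(X)` lies in `L̄^r(X) \ L^r(X)` iff some point `t·x` of its
trajectory lies in the frontier of some r-exterior subset. -/
theorem mem_barLimitR_diff_limitR_iff {X : Type*} [TopologicalSpace X] (φ : ℝ → X → X)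
    (hcont : Continuous fun p : ℝ × X => φ p.1 p.2)
    (h0 : ∀ x, φ 0 x = x)
    (hadd : ∀ t s x, φ t (φ s x) = φ (t + s) x)
    (x : X) (hx : x ∈ barLimitR φ) :
    x ∈ barLimitR φ \ limitR φ ↔
      ∃ E : Set X, RExterior φ E ∧ ∃ t : ℝ, φ t x ∈ frontier E := by
  constructor
  · rintro ⟨hbar, hlim⟩
    simp only [limitR, mem_sInter, mem_ofPred_eq, not_forall] at hlim
    obtain ⟨E, hE, hxE⟩ := hlim
    refine ⟨E, hE, 0, ?_⟩
    rw [h0, hE.1.frontier_eq]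
    exact ⟨mem_iInter₂.mp hbar E hE, hxE⟩
  · rintro ⟨E, hE, t, ht⟩
    rw [hE.1.frontier_eq] at ht
    exact ⟨hx, fun hlim => ht.2 (mem_sInter.mp hlim _ (hE.preimage hcont hadd t))⟩
end

section
/- Let φ be a flow on a topological space X which is locally compact, regular and T1. Then L^r(X) = P(X), L̄^r(X) = closure(Ω^r(X)), and there is a chain of inclusions L^r(X) = P(X) ⊆ P^r(X) ⊆ Ω^r(X) ⊆ closure(Ω^r(X)) = L̄^r(X). -/
open Set

/-- The set of periodic points of the flow. -/
def periodicPts {X : Type*} [TopologicalSpace X] (φ : ℝ → X → X) : Set X :=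
  {x : X | ∃ t : ℝ, t ≠ 0 ∧ φ t x = x}

/-- The right limit set `ω^r(p) = ⋂_{t ≥ 0} closure {s·p : s ≥ t}`. -/
def omegaR {X : Type*} [TopologicalSpace X] (φ : ℝ → X → X) (p : X) : Set X :=
  ⋂ t ∈ Ici (0 : ℝ), closure ((fun s : ℝ => φ s p) '' Ici t)

/-- The `Ω^r`-limit set of the flow. -/
def OmegaR {X : Type*} [TopologicalSpace X] (φ : ℝ → X → X) : Set X :=
  ⋃ p : X, omegaR φ p

/-- The set of right Poisson stable points. -/
def poissonR {X : Type*} [TopologicalSpace X] (φ : ℝ → X → X) : Set X :=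
  {x : X | x ∈ omegaR φ x}

theorem exists_ge_eq_of_mem_periodicPts {X : Type*} [TopologicalSpace X] {φ : ℝ → X → X}
    (h0 : ∀ x, φ 0 x = x) (hadd : ∀ t s x, φ t (φ s x) = φ (t + s) x) {x : X}
    (hx : x ∈ periodicPts φ) (t₀ : ℝ) : ∃ t, t₀ ≤ t ∧ φ t x = x := by
  obtain ⟨T, hT, hTx⟩ : ∃ T : ℝ, 0 < T ∧ φ T x = x := by
    obtain ⟨T, hT, hTx⟩ := hx
    rcases hT.lt_or_gt with h | h
    · refine ⟨-T, by linarith, ?_⟩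
      conv_lhs => rw [← hTx]
      rw [hadd, neg_add_cancel, h0]
    · exact ⟨T, h, hTx⟩
  have hmul : ∀ n : ℕ, φ (n * T) x = x := by
    intro n
    induction n with
    | zero => simp [h0]
    | succ k ih =>
      have h := hadd (k * T) T x
      rw [hTx, ih] at h
      rw [show ((k + 1 : ℕ) : ℝ) * T = k * T + T by push_cast; ring, ← h]
  obtain ⟨n, hn⟩ := exists_nat_ge (t₀ / T)
  exact ⟨n * T, (div_le_iff₀ hT).1 hn, hmul n⟩

theorem limitR_eq_periodicPts {X : Type*} [TopologicalSpace X] [T1Space X] {φ : ℝ → X → X}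
    (h0 : ∀ x, φ 0 x = x) (hadd : ∀ t s x, φ t (φ s x) = φ (t + s) x) :
    limitR φ = periodicPts φ := by
  refine Subset.antisymm (fun x hx => ?_) fun x hx E hE => ?_
  · by_contra hper
    have hE : RExterior φ {x}ᶜ := by
      refine ⟨isOpen_compl_singleton, fun y => ?_⟩
      by_cases hy : ∃ s, φ s y = x
      · obtain ⟨s, hs⟩ := hy
        refine ⟨s + 1, fun t ht hty => hper ⟨t - s, by linarith, ?_⟩⟩
        rw [mem_singleton_iff] at hty
        conv_lhs => rw [← hs]
        rw [hadd, sub_add_cancel, hty]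
      · exact ⟨0, fun t _ hty => hy ⟨t, hty⟩⟩
    exact hx _ hE rfl
  · obtain ⟨t₀, ht₀⟩ := hE.2 x
    obtain ⟨t, ht, htx⟩ := exists_ge_eq_of_mem_periodicPts h0 hadd hx t₀
    exact htx ▸ ht₀ t ht

theorem mem_omegaR_of_mapClusterPt {X : Type*} [TopologicalSpace X] {φ : ℝ → X → X} {p y : X}
    (h : MapClusterPt y Filter.atTop fun s => φ s p) : y ∈ omegaR φ p :=
  mem_iInter₂.2 fun t _ =>
    h.mem_closure_of_mem _ (Filter.image_mem_map (Filter.Ici_mem_atTop t))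

theorem OmegaR_subset_closure {X : Type*} [TopologicalSpace X] {φ : ℝ → X → X} {E : Set X}
    (hE : RExterior φ E) : OmegaR φ ⊆ closure E := by
  refine iUnion_subset fun p y hy => ?_
  obtain ⟨t₀, ht₀⟩ := hE.2 p
  refine closure_mono ?_ (mem_iInter₂.1 hy (max t₀ 0) (mem_Ici.2 (le_max_right _ _)))
  rintro _ ⟨s, hs, rfl⟩
  exact ht₀ s ((le_max_left _ _).trans hs)

theorem rExterior_compl_of_disjoint_OmegaR {X : Type*} [TopologicalSpace X] {φ : ℝ → X → X}
    {K : Set X} (hK : IsCompact K) (hKc : IsClosed K) (hd : Disjoint K (OmegaR φ)) :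
    RExterior φ Kᶜ := by
  refine ⟨hKc.isOpen_compl, fun p => ?_⟩
  by_contra hp
  have hfreq : ∃ᶠ t in Filter.atTop, φ t p ∈ K := by
    rw [Filter.frequently_atTop]
    intro t₀
    by_contra! h
    exact hp ⟨t₀, h⟩
  obtain ⟨y, hyK, hy⟩ := hK.exists_mapClusterPt_of_frequently hfreq
  exact disjoint_left.1 hd hyK (mem_iUnion.2 ⟨p, mem_omegaR_of_mapClusterPt hy⟩)

theorem barLimitR_eq_closure_OmegaR {X : Type*} [TopologicalSpace X] [LocallyCompactSpace X]
    [RegularSpace X] (φ : ℝ → X → X) : barLimitR φ = closure (OmegaR φ) := by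
  refine Subset.antisymm (fun y hy => ?_) ?_
  · by_contra hyΩ
    obtain ⟨K, ⟨hKy, hK, hKc⟩, hKΩ⟩ := (isCompact_isClosed_basis_nhds y).mem_iff.1
      (isClosed_closure.isOpen_compl.mem_nhds hyΩ)
    have hd : Disjoint K (OmegaR φ) :=
      (disjoint_left.2 hKΩ).mono_right subset_closure
    have hmem := mem_iInter₂.1 hy _ (rExterior_compl_of_disjoint_OmegaR hK hKc hd)
    rw [closure_compl] at hmem
    exact hmem (mem_interior_iff_mem_nhds.2 hKy)
  · exact subset_iInter₂ fun E hE => closure_minimal (OmegaR_subset_closure hE) isClosed_closure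

theorem periodicPts_subset_poissonR {X : Type*} [TopologicalSpace X] {φ : ℝ → X → X}
    (h0 : ∀ x, φ 0 x = x) (hadd : ∀ t s x, φ t (φ s x) = φ (t + s) x) :
    periodicPts φ ⊆ poissonR φ := by
  intro x hx
  exact mem_iInter₂.2 fun t _ => subset_closure (exists_ge_eq_of_mem_periodicPts h0 hadd hx t)

/-- On a locally compact `T₃` (regular `T1`) space: `L^r(X) = P(X)`,
`L̄^r(X) = closure (Ω^r(X))`, and the chain of inclusions
`L^r(X) = P(X) ⊆ P^r(X) ⊆ Ω^r(X) ⊆ closure (Ω^r(X)) = L̄^r(X)`. -/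
theorem limitR_chain {X : Type*} [TopologicalSpace X]
    [LocallyCompactSpace X] [RegularSpace X] [T1Space X] (φ : ℝ → X → X)
    (hcont : Continuous fun p : ℝ × X => φ p.1 p.2)
    (h0 : ∀ x, φ 0 x = x)
    (hadd : ∀ t s x, φ t (φ s x) = φ (t + s) x) :
    limitR φ = periodicPts φ ∧ barLimitR φ = closure (OmegaR φ) ∧
    periodicPts φ ⊆ poissonR φ ∧ poissonR φ ⊆ OmegaR φ ∧
    OmegaR φ ⊆ closure (OmegaR φ) := by
  exact ⟨limitR_eq_periodicPts h0 hadd, barLimitR_eq_closure_OmegaR φ,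
    periodicPts_subset_poissonR h0 hadd, fun x hx => mem_iUnion.2 ⟨x, hx⟩, subset_closure⟩
end
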